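/- There exists a constant c > 0, depending only on λ = sup_k m_k, such that for every martingale f ∈ H_{1/2} and every integer n ≥ 2, (1/log n) · Σ_{k=1}^n ‖σ_k f‖_{L_{1/2}(μ)}^{1/2} / k ≤ c · ‖f‖_{H_{1/2}}^{1/2}. -/

import Mathlib

open MeasureTheory Complex Finset
open scoped BigOperators ENNReal NNReal

noncomputable section

instance (n : ℕ) : MeasurableSpace (ZMod n) := ⊤

/-- The Vilenkin group determined by the generating sequence `m`. -/
abbrev Gm (m : ℕ → ℕ) : Type := ∀ _k : ℕ, ZMod (m _k)

namespace Vilenkin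

variable (m : ℕ → ℕ)

/-- The generalized powers `M_0 = 1`, `M_{k+1} = m_k · M_k`. -/
def M : ℕ → ℕ
  | 0 => 1
  | k + 1 => m k * M k

/-- The `j`-th digit `n_j` of `n` in the generalized number system based on `m`. -/
def digit (n j : ℕ) : ℕ := n / M m j % m j

/-- `|n|`, the index of the highest nonzero digit of `n`. -/
def hi (n : ℕ) : ℕ := Nat.findGreatest (fun j => digit m n j ≠ 0) n

/-- `⟨n⟩`, the index of the lowest nonzero digit of `n`. -/
def lo (n : ℕ) : ℕ := sInf {j | digit m n j ≠ 0}

/-- The generalized Rademacher functions `r_k(x) = exp(2πi x_k / m_k)`. -/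
def rad (k : ℕ) (x : Gm m) : ℂ :=
  Complex.exp (2 * Real.pi * Complex.I * ((x k).val : ℂ) / (m k : ℂ))

/-- The Vilenkin functions `ψ_n = ∏_k r_k^{n_k}`. -/
def vil (n : ℕ) (x : Gm m) : ℂ :=
  ∏ k ∈ Finset.range (n + 1), rad m k x ^ digit m n k

/-- The Dirichlet kernels `D_n = ∑_{k=0}^{n-1} ψ_k`. -/
def D (n : ℕ) (x : Gm m) : ℂ := ∑ k ∈ Finset.range n, vil m k x

/-- The Fejér kernels `K_n = (1/n) ∑_{k=1}^{n} D_k`. -/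
def K (n : ℕ) (x : Gm m) : ℂ := (n : ℂ)⁻¹ * ∑ k ∈ Finset.range n, D m (k + 1) x

/-- The Nörlund kernels `F_n = (1/Q_n) ∑_{k=1}^{n} q_{n-k} D_k` where
`Q_n = ∑_{k=0}^{n-1} q_k`. -/
def FK (q : ℕ → ℝ) (n : ℕ) (x : Gm m) : ℂ :=
  ((∑ k ∈ Finset.range n, q k : ℝ) : ℂ)⁻¹ *
    ∑ k ∈ Finset.range n, (q (n - (k + 1)) : ℂ) * D m (k + 1) x

/-- The cylinder subgroup `I_n = {x : x_0 = … = x_{n-1} = 0}`. -/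
def I (n : ℕ) : Set (Gm m) := {x | ∀ k < n, x k = 0}

/-- The cylinder of length `n` around `x`. -/
def cylAt (n : ℕ) (x : Gm m) : Set (Gm m) := {y | ∀ k < n, y k = x k}

/-- `μ` is the normalized Haar measure of `G_m`: the (unique) Borel probability
measure giving each cylinder of length `n` measure `1 / M_n`. -/
def IsHaar (μ : Measure (Gm m)) : Prop :=
  ∀ (n : ℕ) (x : Gm m), μ (cylAt m n x) = (M m n : ℝ≥0∞)⁻¹

/-- A martingale with respect to the filtration `(ℱ_n)` on `G_m`, where `ℱ_n` is
generated by the first `n` coordinates: each `f n` is integrable and depends only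
on the first `n` coordinates, and the conditional expectation of `f N` with
respect to `ℱ_n` (which under the Haar measure is given by averaging over the
cylinders of length `n`) equals `f n` for `n ≤ N`. -/
structure IsMartingale (μ : Measure (Gm m)) (f : ℕ → Gm m → ℂ) : Prop where
  integrable : ∀ n, Integrable (f n) μ
  adapted : ∀ (n : ℕ) (x y : Gm m), (∀ k < n, x k = y k) → f n x = f n y
  mart : ∀ n N : ℕ, n ≤ N → ∀ x : Gm m,
    f n x = (M m n : ℂ) * ∫ t in cylAt m n x, f N t ∂μ

/-- The Vilenkin–Fourier coefficients of a martingale: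
`f̂(i) = lim_k ∫ f^(k) conj(ψ_i) dμ`; for a martingale these integrals are
constant as soon as `M_k > i`, in particular from `k = i + 1` on. -/
def coeff (μ : Measure (Gm m)) (f : ℕ → Gm m → ℂ) (i : ℕ) : ℂ :=
  ∫ x, f (i + 1) x * (starRingEnd ℂ) (vil m i x) ∂μ

/-- The partial sums `S_n f = ∑_{k=0}^{n-1} f̂(k) ψ_k`. -/
def S (μ : Measure (Gm m)) (f : ℕ → Gm m → ℂ) (n : ℕ) (x : Gm m) : ℂ :=
  ∑ k ∈ Finset.range n, coeff m μ f k * vil m k x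

/-- The Fejér means `σ_n f = (1/n) ∑_{k=1}^{n} S_k f`. -/
def sigma (μ : Measure (Gm m)) (f : ℕ → Gm m → ℂ) (n : ℕ) (x : Gm m) : ℂ :=
  (n : ℂ)⁻¹ * ∑ k ∈ Finset.range n, S m μ f (k + 1) x

/-- The Nörlund means `t_n f = (1/Q_n) ∑_{k=1}^{n} q_{n-k} S_k f`. -/
def T (μ : Measure (Gm m)) (q : ℕ → ℝ) (f : ℕ → Gm m → ℂ) (n : ℕ) (x : Gm m) : ℂ :=
  ((∑ k ∈ Finset.range n, q k : ℝ) : ℂ)⁻¹ *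
    ∑ k ∈ Finset.range n, (q (n - (k + 1)) : ℂ) * S m μ f (k + 1) x

/-- The martingale maximal function `f* = sup_n |f^(n)|`. -/
def mstar (f : ℕ → Gm m → ℂ) (x : Gm m) : ℝ≥0∞ := ⨆ n, (‖f n x‖₊ : ℝ≥0∞)

/-- The `L_p`-type quasi-norm `(∫ g^p dμ)^{1/p}` of an `ℝ≥0∞`-valued function. -/
def eLp (μ : Measure (Gm m)) (p : ℝ) (g : Gm m → ℝ≥0∞) : ℝ≥0∞ :=
  (∫⁻ x, g x ^ p ∂μ) ^ (1 / p)

/-- Membership in the martingale Hardy space `H_p`: `‖f‖_{H_p} = ‖f*‖_{L_p} < ∞`. -/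
def MemHp (μ : Measure (Gm m)) (p : ℝ) (f : ℕ → Gm m → ℂ) : Prop :=
  eLp m μ p (mstar m f) ≠ ⊤

/-- The weak-`L_p` quasi-norm `sup_{t>0} t · μ(g > t)^{1/p}`. -/
def wLp (μ : Measure (Gm m)) (p : ℝ) (g : Gm m → ℝ≥0∞) : ℝ≥0∞ :=
  ⨆ t : ℝ≥0, (t : ℝ≥0∞) * μ {x | (t : ℝ≥0∞) < g x} ^ (1 / p)

end Vilenkin

namespace Vilenkin

section Arithmetic

variable (m : ℕ → ℕ)

lemma M_succ (k : ℕ) : M m (k + 1) = m k * M m k := rfl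

lemma M_pos (hm : ∀ k, 2 ≤ m k) (k : ℕ) : 0 < M m k := by
  induction k with
  | zero => exact Nat.one_pos
  | succ k ih => exact Nat.mul_pos (by have := hm k; omega) ih

lemma two_mul_M_le (hm : ∀ k, 2 ≤ m k) (k : ℕ) : 2 * M m k ≤ M m (k + 1) :=
  Nat.mul_le_mul_right _ (hm k)

lemma M_dvd {j k : ℕ} (h : j ≤ k) : M m j ∣ M m k := by
  induction h with
  | refl => exact dvd_rfl
  | step _ ih => exact ih.trans (Dvd.intro_left _ rfl)

lemma M_le (hm : ∀ k, 2 ≤ m k) {j k : ℕ} (h : j ≤ k) : M m j ≤ M m k :=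
  Nat.le_of_dvd (M_pos m hm k) (M_dvd m h)

lemma two_pow_le_M (hm : ∀ k, 2 ≤ m k) (k : ℕ) : 2 ^ k ≤ M m k := by
  induction k with
  | zero => exact le_rfl
  | succ k ih => have := two_mul_M_le m hm k; rw [pow_succ]; omega

lemma lt_M (hm : ∀ k, 2 ≤ m k) (k : ℕ) : k < M m k :=
  Nat.lt_two_pow_self.trans_le (two_pow_le_M m hm k)

lemma digit_eq_zero (hm : ∀ k, 2 ≤ m k) {r j k : ℕ} (hr : r < M m j) (hk : j ≤ k) :
    digit m r k = 0 := by
  rw [digit, Nat.div_eq_of_lt (hr.trans_le (M_le m hm hk)), Nat.zero_mod]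

lemma digit_block_lt {b r j k : ℕ} (hk : k < j) :
    digit m (b * M m j + r) k = digit m r k := by
  have h : M m k * m k ∣ b * M m j := by
    rw [mul_comm, ← M_succ]; exact (M_dvd m hk).mul_left b
  obtain ⟨c, hc⟩ := h
  rw [digit, digit, ← Nat.mod_mul_right_div_self, ← Nat.mod_mul_right_div_self, hc,
    Nat.mul_add_mod]

lemma digit_block_self (hm : ∀ k, 2 ≤ m k) {b r j : ℕ} (hb : b < m j) (hr : r < M m j) :
    digit m (b * M m j + r) j = b := by
  rw [digit, mul_comm, Nat.mul_add_div (M_pos m hm j), Nat.div_eq_of_lt hr, add_zero,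
    Nat.mod_eq_of_lt hb]

lemma block_lt {b r j : ℕ} (hb : b < m j) (hr : r < M m j) : b * M m j + r < M m (j + 1) := by
  rw [M_succ]
  have : (b + 1) * M m j ≤ m j * M m j := Nat.mul_le_mul_right _ hb
  nlinarith

end Arithmetic

section Characters

variable (m : ℕ → ℕ)

lemma vil_eq_prod (hm : ∀ k, 2 ≤ m k) {r j : ℕ} (hr : r < M m j) (x : Gm m) :
    vil m r x = ∏ k ∈ Finset.range j, rad m k x ^ digit m r k := by
  have key : ∀ a b : ℕ, a ≤ b → r < M m a → ∏ k ∈ Finset.range a, rad m k x ^ digit m r k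
      = ∏ k ∈ Finset.range b, rad m k x ^ digit m r k := by
    intro a b hab ha
    refine Finset.prod_subset (Finset.range_mono hab) fun k _ hk => ?_
    rw [digit_eq_zero m hm ha (by simpa using hk), pow_zero]
  have hr' : r < M m (r + 1) := (Nat.lt_succ_self r).trans (lt_M m hm _)
  rw [vil]
  rcases le_total (r + 1) j with h | h
  · exact key _ _ h hr'
  · exact (key _ _ h hr).symm

lemma vil_block (hm : ∀ k, 2 ≤ m k) {b r j : ℕ} (hb : b < m j) (hr : r < M m j) (x : Gm m) :
    vil m (b * M m j + r) x = rad m j x ^ b * vil m r x := by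
  rw [vil_eq_prod m hm (block_lt m hb hr), vil_eq_prod m hm hr, Finset.prod_range_succ,
    digit_block_self m hm hb hr, mul_comm]
  congr 1
  exact Finset.prod_congr rfl fun k hk => by rw [digit_block_lt m (Finset.mem_range.1 hk)]

lemma vil_congr (hm : ∀ k, 2 ≤ m k) {r j : ℕ} (hr : r < M m j) {x y : Gm m}
    (h : ∀ k < j, x k = y k) : vil m r x = vil m r y := by
  rw [vil_eq_prod m hm hr, vil_eq_prod m hm hr]
  exact Finset.prod_congr rfl fun k hk => by rw [rad, rad, h k (Finset.mem_range.1 hk)]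

lemma rad_eq_stdAddChar [∀ k, NeZero (m k)] (k : ℕ) (x : Gm m) :
    rad m k x = ZMod.stdAddChar (x k) := by
  rw [ZMod.stdAddChar_apply, ZMod.toCircle_apply, rad]

/-- The kernel `r_j(x) conj(r_j(t))` of the `j`-th Rademacher function. -/
def radKer (j : ℕ) (x t : Gm m) : ℂ := rad m j x * (starRingEnd ℂ) (rad m j t)

/-- The kernel `ψ_k(x) conj(ψ_k(t))` of the `k`-th Vilenkin function. -/
def vilKer (k : ℕ) (x t : Gm m) : ℂ := vil m k x * (starRingEnd ℂ) (vil m k t)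

lemma radKer_eq [∀ k, NeZero (m k)] (j : ℕ) (x t : Gm m) :
    radKer m j x t = ZMod.stdAddChar (x j - t j) := by
  rw [radKer, rad_eq_stdAddChar, rad_eq_stdAddChar, sub_eq_add_neg, AddChar.map_add_eq_mul,
    AddChar.map_neg_eq_conj]

lemma norm_radKer [∀ k, NeZero (m k)] (j : ℕ) (x t : Gm m) : ‖radKer m j x t‖ = 1 := by
  rw [radKer_eq, ZMod.stdAddChar_apply, Circle.norm_coe]

lemma geom_sum_radKer [∀ k, NeZero (m k)] (j : ℕ) (x t : Gm m) :
    ∑ b ∈ Finset.range (m j), radKer m j x t ^ b = if x j = t j then (m j : ℂ) else 0 := by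
  rw [radKer_eq]
  split_ifs with h
  · simp [h]
  · have hne : (ZMod.stdAddChar (x j - t j) : ℂ) ≠ 1 := by
      intro h1
      rw [← AddChar.map_zero_eq_one (ZMod.stdAddChar (N := m j))] at h1
      exact h (sub_eq_zero.1 (ZMod.injective_stdAddChar h1))
    have hp : (ZMod.stdAddChar (x j - t j) : ℂ) ^ m j = 1 := by
      rw [← AddChar.map_nsmul_eq_pow]; simp
    rw [geom_sum_eq hne, hp, sub_self, zero_div]

lemma vilKer_block (hm : ∀ k, 2 ≤ m k) {b r j : ℕ} (hb : b < m j) (hr : r < M m j)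
    (x t : Gm m) : vilKer m (b * M m j + r) x t = radKer m j x t ^ b * vilKer m r x t := by
  rw [vilKer, vil_block m hm hb hr, vil_block m hm hb hr, vilKer, radKer, map_mul, map_pow,
    mul_pow]
  ring

/-- The Dirichlet kernel of order `M_j`. -/
def dirKer (j : ℕ) (x t : Gm m) : ℂ := ∑ k ∈ Finset.range (M m j), vilKer m k x t

/-- `n` times the Fejér kernel of order `n`. -/
def fejKer (n : ℕ) (x t : Gm m) : ℂ :=
  ∑ k ∈ Finset.range n, ((n : ℂ) - k) * vilKer m k x t

lemma dirKer_zero (x t : Gm m) : dirKer m 0 x t = 1 := by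
  simp [dirKer, M, vilKer, vil, digit]

lemma fejKer_M_zero (x t : Gm m) : fejKer m (M m 0) x t = 1 := by
  simp [fejKer, M, vilKer, vil, digit]

lemma sum_block_dirKer (hm : ∀ k, 2 ≤ m k) (j a : ℕ) (ha : a ≤ m j) (x t : Gm m) :
    ∑ k ∈ Finset.range (a * M m j), vilKer m k x t
      = (∑ b ∈ Finset.range a, radKer m j x t ^ b) * dirKer m j x t := by
  induction a with
  | zero => simp
  | succ a ih =>
    rw [add_mul, one_mul, Finset.sum_range_add, ih (by omega), Finset.sum_range_succ, add_mul,
      dirKer, Finset.mul_sum (a := radKer m j x t ^ a)]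
    congr 1
    exact Finset.sum_congr rfl fun r hr =>
      vilKer_block m hm (by omega) (Finset.mem_range.1 hr) x t

lemma sum_block_fejKer (hm : ∀ k, 2 ≤ m k) (c : ℂ) (j a : ℕ) (ha : a ≤ m j) (x t : Gm m) :
    ∑ k ∈ Finset.range (a * M m j), (c - k) * vilKer m k x t
      = ∑ b ∈ Finset.range a, radKer m j x t ^ b *
          ((c - (b + 1) * M m j) * dirKer m j x t + fejKer m (M m j) x t) := by
  induction a with
  | zero => simp
  | succ a ih =>
    rw [add_mul, one_mul, Finset.sum_range_add, ih (by omega), Finset.sum_range_succ]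
    congr 1
    rw [dirKer, fejKer, Finset.mul_sum, ← Finset.sum_add_distrib, Finset.mul_sum]
    refine Finset.sum_congr rfl fun r hr => ?_
    rw [vilKer_block m hm (by omega) (Finset.mem_range.1 hr)]
    push_cast
    ring

lemma dirKer_succ [∀ k, NeZero (m k)] (hm : ∀ k, 2 ≤ m k) (j : ℕ) (x t : Gm m) :
    dirKer m (j + 1) x t = (if x j = t j then (m j : ℂ) else 0) * dirKer m j x t := by
  rw [← geom_sum_radKer, ← sum_block_dirKer m hm j (m j) le_rfl, dirKer, M_succ]

open scoped Classical in
lemma dirKer_eq [∀ k, NeZero (m k)] (hm : ∀ k, 2 ≤ m k) (j : ℕ) (x t : Gm m) :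
    dirKer m j x t = if t ∈ cylAt m j x then (M m j : ℂ) else 0 := by
  induction j with
  | zero => rw [dirKer_zero]; simp [cylAt, M]
  | succ j ih =>
    have hiff : t ∈ cylAt m (j + 1) x ↔ x j = t j ∧ t ∈ cylAt m j x := by
      simp only [cylAt, Set.mem_ofPred_eq, Nat.lt_succ_iff_lt_or_eq, or_imp, forall_and,
        forall_eq]
      rw [and_comm, eq_comm]
    rw [dirKer_succ m hm, ih, M_succ]
    by_cases h1 : x j = t j <;> by_cases h2 : t ∈ cylAt m j x <;> simp [hiff, h1, h2]

lemma fejKer_M_succ [∀ k, NeZero (m k)] (hm : ∀ k, 2 ≤ m k) (j : ℕ) (x t : Gm m) :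
    fejKer m (M m (j + 1)) x t
      = (∑ b ∈ Finset.range (m j), radKer m j x t ^ b * (((m j : ℂ) - (b + 1)) * M m j)) *
          dirKer m j x t
        + (if x j = t j then (m j : ℂ) else 0) * fejKer m (M m j) x t := by
  rw [← geom_sum_radKer, fejKer, M_succ, sum_block_fejKer m hm _ j (m j) le_rfl,
    Finset.sum_mul, Finset.sum_mul, ← Finset.sum_add_distrib]
  refine Finset.sum_congr rfl fun b _ => ?_
  push_cast
  ring

/-- The points agreeing with `x` in all coordinates below `j` except possibly the `s`-th. -/
def cylExcept (j s : ℕ) (x : Gm m) : Set (Gm m) := {t | ∀ k < j, k ≠ s → t k = x k}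

open scoped Classical in
/-- A nonnegative majorant for the Fejér kernel of order `M_j`, divided by `M_j`. -/
def majKer (j : ℕ) (x t : Gm m) : ℝ :=
  M m j * (if t ∈ cylAt m j x then 1 else 0)
    + ∑ s ∈ Finset.range j, (M m s : ℝ) * (if t ∈ cylExcept m j s x then 1 else 0)

lemma majKer_nonneg (j : ℕ) (x t : Gm m) : 0 ≤ majKer m j x t := by
  unfold majKer; positivity

lemma mem_cylAt_succ_iff {j : ℕ} {x t : Gm m} :
    t ∈ cylAt m (j + 1) x ↔ t ∈ cylAt m j x ∧ t j = x j := by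
  simp only [cylAt, Set.mem_ofPred_eq, Nat.lt_succ_iff_lt_or_eq, or_imp, forall_and, forall_eq]

lemma mem_cylExcept_succ_iff {j s : ℕ} (hs : s < j) {x t : Gm m} :
    t ∈ cylExcept m (j + 1) s x ↔ t ∈ cylExcept m j s x ∧ t j = x j := by
  simp only [cylExcept, Set.mem_ofPred_eq, Nat.lt_succ_iff_lt_or_eq, or_imp, forall_and, forall_eq]
  simp [hs.ne']

lemma mem_cylExcept_self_iff {j : ℕ} {x t : Gm m} :
    t ∈ cylExcept m (j + 1) j x ↔ t ∈ cylAt m j x := by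
  simp only [cylExcept, cylAt, Set.mem_ofPred_eq, Nat.lt_succ_iff_lt_or_eq, or_imp, forall_and,
    forall_eq]
  simp only [ne_eq, not_true_eq_false, false_imp_iff, and_true]
  exact forall₂_congr fun k hk => by simp [hk.ne]

variable {lam : ℕ} [∀ k, NeZero (m k)] (hm : ∀ k, 2 ≤ m k) (hlam : ∀ k, m k ≤ lam)
include hlam

lemma norm_block_coeff_le (j : ℕ) (x t : Gm m) :
    ‖∑ b ∈ Finset.range (m j), radKer m j x t ^ b * (((m j : ℂ) - (b + 1)) * M m j)‖
      ≤ (lam : ℝ) ^ 2 * M m j := by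
  have hl : (m j : ℝ) ≤ lam := by exact_mod_cast hlam j
  have hM : (0 : ℝ) ≤ M m j := Nat.cast_nonneg _
  calc _ ≤ ∑ b ∈ Finset.range (m j), (lam : ℝ) * M m j := by
        refine norm_sum_le_of_le _ fun b hb => ?_
        have hb' : b + 1 ≤ m j := Finset.mem_range.1 hb
        have : ((m j : ℂ) - (b + 1)) = ((m j - (b + 1) : ℕ) : ℂ) := by
          rw [Nat.cast_sub hb']; push_cast; ring
        rw [norm_mul, norm_pow, norm_radKer, one_pow, one_mul, norm_mul, this, Complex.norm_natCast,
          Complex.norm_natCast]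
        refine mul_le_mul_of_nonneg_right ?_ hM
        exact_mod_cast (Nat.sub_le _ _).trans (hlam j)
    _ ≤ _ := by
        rw [Finset.sum_const, Finset.card_range, nsmul_eq_mul, sq, mul_assoc]
        exact mul_le_mul_of_nonneg_right hl (by positivity)

include hm

open scoped Classical in
lemma norm_fejKer_M_le_aux (j : ℕ) (x t : Gm m) :
    ‖fejKer m (M m j) x t‖ ≤ M m j * ((if t ∈ cylAt m j x then 1 else 0)
      + (lam : ℝ) ^ 2 * ∑ s ∈ Finset.range j,
          (M m s : ℝ) * (if t ∈ cylExcept m j s x then 1 else 0)) := by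
  induction j with
  | zero => rw [fejKer_M_zero]; simp [cylAt, M]
  | succ j ih =>
    rw [fejKer_M_succ m hm]
    have h1 : ‖(∑ b ∈ Finset.range (m j), radKer m j x t ^ b * (((m j : ℂ) - (b + 1)) * M m j)) *
        dirKer m j x t‖ ≤ (lam : ℝ) ^ 2 * M m j * (M m (j + 1) *
          (if t ∈ cylAt m j x then 1 else 0)) := by
      rw [norm_mul]
      refine mul_le_mul (norm_block_coeff_le m hlam j x t) ?_ (norm_nonneg _) (by positivity)
      rw [dirKer_eq m hm]
      have : (M m j : ℝ) ≤ M m (j + 1) := by exact_mod_cast M_le m hm (Nat.le_succ j)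
      split_ifs <;> simp [this]
    have h2 : ‖(if x j = t j then (m j : ℂ) else 0) * fejKer m (M m j) x t‖
        ≤ M m (j + 1) * ((if t ∈ cylAt m (j + 1) x then 1 else 0) + (lam : ℝ) ^ 2 *
          ∑ s ∈ Finset.range j, (M m s : ℝ) * (if t ∈ cylExcept m (j + 1) s x then 1 else 0)) := by
      by_cases h : x j = t j
      · have e : ∀ s ∈ Finset.range j,
            (M m s : ℝ) * (if t ∈ cylExcept m (j + 1) s x then 1 else 0)
              = M m s * (if t ∈ cylExcept m j s x then 1 else 0) := fun s hs => by
          simp only [mem_cylExcept_succ_iff m (Finset.mem_range.1 hs), h, and_true]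
        rw [if_pos h, norm_mul, Complex.norm_natCast, M_succ, Nat.cast_mul, mul_assoc,
          Finset.sum_congr rfl e]
        simp only [mem_cylAt_succ_iff, h, and_true]
        exact mul_le_mul_of_nonneg_left ih (Nat.cast_nonneg _)
      · rw [if_neg h, zero_mul, norm_zero]
        positivity
    refine (norm_add_le _ _).trans ((add_le_add h1 h2).trans_eq ?_)
    rw [Finset.sum_range_succ]
    simp only [mem_cylExcept_self_iff]
    ring

lemma norm_fejKer_M_le (j : ℕ) (x t : Gm m) :
    ‖fejKer m (M m j) x t‖ ≤ (lam : ℝ) ^ 2 * (M m j * majKer m j x t) := by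
  refine (norm_fejKer_M_le_aux m hm hlam j x t).trans ?_
  have hl : (1 : ℝ) ≤ (lam : ℝ) ^ 2 := by
    exact_mod_cast Nat.one_le_pow _ _ (by have := hm 0; have := hlam 0; omega)
  have hM : (1 : ℝ) ≤ M m j := by exact_mod_cast M_pos m hm j
  rw [majKer, mul_left_comm, mul_add ((lam : ℝ) ^ 2)]
  refine mul_le_mul_of_nonneg_left ?_ (by positivity)
  gcongr
  rw [← mul_assoc]
  refine le_mul_of_one_le_left (by positivity) (one_le_mul_of_one_le_of_one_le hl hM)

omit hlam in
lemma norm_dirKer_le (j : ℕ) (x t : Gm m) : ‖dirKer m j x t‖ ≤ majKer m j x t := by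
  classical
  rw [dirKer_eq m hm, majKer]
  have : 0 ≤ ∑ s ∈ Finset.range j, (M m s : ℝ) * (if t ∈ cylExcept m j s x then 1 else 0) := by
    positivity
  by_cases h : t ∈ cylAt m j x
  · simp only [h, if_true, Complex.norm_natCast, mul_one]
    convert le_add_of_nonneg_right this
  · simp only [h, if_false, norm_zero, mul_zero, zero_add]
    convert this

lemma norm_fejKer_le (J n : ℕ) (hn : n < M m J) (x t : Gm m) :
    ‖fejKer m n x t‖ ≤ 2 * (lam : ℝ) ^ 3 * ∑ j ∈ Finset.range J, M m j * majKer m j x t := by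
  induction J generalizing n with
  | zero =>
    obtain rfl : n = 0 := by simpa [M] using hn
    simp [fejKer]
  | succ J ih =>
    have hMp := M_pos m hm J
    set a := n / M m J with ha
    set r := n % M m J with hr
    have hrlt : r < M m J := Nat.mod_lt _ hMp
    have halt : a < m J := Nat.div_lt_of_lt_mul (by rwa [mul_comm])
    have hnar : n = a * M m J + r := (Nat.div_add_mod' n _).symm
    have split : fejKer m n x t = ∑ b ∈ Finset.range a, radKer m J x t ^ b *
        (((n : ℂ) - (b + 1) * M m J) * dirKer m J x t + fejKer m (M m J) x t)
          + radKer m J x t ^ a * fejKer m r x t := by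
      rw [← sum_block_fejKer m hm n J a halt.le, fejKer, fejKer, Finset.mul_sum]
      conv_lhs => rw [hnar, Finset.sum_range_add]
      rw [← hnar]
      congr 1
      refine Finset.sum_congr rfl fun i hi => ?_
      rw [vilKer_block m hm halt ((Finset.mem_range.1 hi).trans hrlt)]
      have : (n : ℂ) = a * M m J + r := by exact_mod_cast hnar
      rw [this]
      push_cast
      ring
    have hl1 : (1 : ℝ) ≤ lam := by
      exact_mod_cast (by have := hm 0; have := hlam 0; omega : 1 ≤ lam)
    have hterm : ∀ b ∈ Finset.range a, ‖radKer m J x t ^ b *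
        (((n : ℂ) - (b + 1) * M m J) * dirKer m J x t + fejKer m (M m J) x t)‖
          ≤ 2 * (lam : ℝ) ^ 2 * (M m J * majKer m J x t) := by
      intro b hb
      have hb' : b + 1 ≤ a := Finset.mem_range.1 hb
      have h1 : (b + 1) * M m J ≤ n := (Nat.mul_le_mul_right _ hb').trans (by omega)
      have h2 : ((n : ℂ) - (b + 1) * M m J) = ((n - (b + 1) * M m J : ℕ) : ℂ) := by
        rw [Nat.cast_sub h1]; push_cast; ring
      have h3 : ((n - (b + 1) * M m J : ℕ) : ℝ) ≤ (lam : ℝ) ^ 2 * M m J := by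
        have : (n : ℝ) ≤ lam * M m J := by
          exact_mod_cast hn.le.trans (Nat.mul_le_mul_right _ (hlam J))
        have h4 : ((n - (b + 1) * M m J : ℕ) : ℝ) ≤ n := by exact_mod_cast Nat.sub_le _ _
        have h5 : (lam : ℝ) * M m J ≤ lam ^ 2 * M m J := by
          gcongr
          nlinarith
        linarith
      rw [norm_mul, norm_pow, norm_radKer, one_pow, one_mul]
      refine (norm_add_le _ _).trans ?_
      rw [norm_mul, h2, Complex.norm_natCast]
      have h6 := mul_le_mul h3 (norm_dirKer_le m hm J x t) (norm_nonneg _) (by positivity)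
      have h7 := norm_fejKer_M_le m hm hlam J x t
      linarith
    rw [split, Finset.sum_range_succ, mul_add, add_comm]
    refine (norm_add_le _ _).trans (add_le_add ?_ ?_)
    · rw [norm_mul, norm_pow, norm_radKer, one_pow, one_mul]
      exact ih r hrlt
    · refine (norm_sum_le_of_le _ hterm).trans ?_
      rw [Finset.sum_const, Finset.card_range, nsmul_eq_mul]
      have : (a : ℝ) ≤ lam := by exact_mod_cast halt.le.trans (hlam J)
      have hk := mul_nonneg (Nat.cast_nonneg (α := ℝ) (M m J)) (majKer_nonneg m J x t)
      calc _ ≤ (lam : ℝ) * (2 * lam ^ 2 * (M m J * majKer m J x t)) := by gcongr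
        _ = _ := by ring

end Characters

section FiniteModel

variable (m : ℕ → ℕ)

lemma mem_cylAt_comm {j : ℕ} {x t : Gm m} : t ∈ cylAt m j x ↔ x ∈ cylAt m j t :=
  forall₂_congr fun _ _ => eq_comm

lemma cylAt_eq_of_mem {j : ℕ} {x t : Gm m} (h : t ∈ cylAt m j x) : cylAt m j t = cylAt m j x := by
  ext y
  exact forall₂_congr fun k hk => by rw [h k hk]

lemma cylAt_anti {i j : ℕ} (hij : i ≤ j) (x : Gm m) : cylAt m j x ⊆ cylAt m i x :=
  fun _ h k hk => h k (hk.trans_le hij)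

lemma measurableSet_cylAt (j : ℕ) (x : Gm m) : MeasurableSet (cylAt m j x) := by
  have : cylAt m j x = ⋂ k ∈ Finset.range j, (fun y : Gm m => y k) ⁻¹' {x k} := by
    ext y; simp [cylAt]
  rw [this]
  exact Finset.measurableSet_biInter _ fun k _ =>
    measurable_pi_apply k (show MeasurableSet ({x k} : Set (ZMod (m k))) from trivial)

variable [∀ k, NeZero (m k)]

open scoped Classical in
/-- Representatives of the cylinders of length `L`: the points vanishing from the `L`-th
coordinate on. -/
def reps (L : ℕ) : Finset (Gm m) :=
  Finset.univ.image fun (c : ∀ k : Fin L, ZMod (m k)) (k : ℕ) => if h : k < L then c ⟨k, h⟩ else 0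

lemma mem_reps {L : ℕ} {x : Gm m} : x ∈ reps m L ↔ ∀ k, L ≤ k → x k = 0 := by
  classical
  simp only [reps, Finset.mem_image, Finset.mem_univ, true_and]
  constructor
  · rintro ⟨c, rfl⟩ k hk
    simp [not_lt.2 hk]
  · intro h
    refine ⟨fun k => x k, funext fun k => ?_⟩
    split_ifs with hk
    · rfl
    · exact (h k (not_lt.1 hk)).symm

open scoped Classical in
/-- The representatives of the cylinders of length `L` inside a cylinder of length `j`. -/
def repsIn (L j : ℕ) (x : Gm m) : Finset (Gm m) := {t ∈ reps m L | t ∈ cylAt m j x}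

lemma mem_repsIn {L j : ℕ} {x t : Gm m} :
    t ∈ repsIn m L j x ↔ t ∈ reps m L ∧ t ∈ cylAt m j x := by
  classical
  simp [repsIn]

lemma repsIn_zero (L : ℕ) (x : Gm m) : repsIn m L 0 x = reps m L := by
  ext t; simp [mem_repsIn, cylAt]

lemma repsIn_subset {L i j : ℕ} (hij : i ≤ j) (x : Gm m) : repsIn m L j x ⊆ repsIn m L i x :=
  fun t ht => by
    rw [mem_repsIn] at ht ⊢
    exact ⟨ht.1, cylAt_anti m hij x ht.2⟩

lemma repsIn_eq_of_mem {L j : ℕ} {x t : Gm m} (h : t ∈ cylAt m j x) :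
    repsIn m L j t = repsIn m L j x := by
  ext y; rw [mem_repsIn, mem_repsIn, cylAt_eq_of_mem m h]

lemma exists_reps (L : ℕ) (x : Gm m) : ∃ t ∈ reps m L, t ∈ cylAt m L x :=
  ⟨fun k => if k < L then x k else 0, (mem_reps m).2 fun k hk => by simp [not_lt.2 hk],
    fun k hk => by simp [hk]⟩

lemma cylAt_eq_biUnion {L j : ℕ} (hj : j ≤ L) (x : Gm m) :
    cylAt m j x = ⋃ t ∈ repsIn m L j x, cylAt m L t := by
  ext y
  simp only [Set.mem_iUnion, exists_prop, mem_repsIn]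
  constructor
  · intro hy
    obtain ⟨t, ht, hty⟩ := exists_reps m L y
    refine ⟨t, ⟨ht, fun k hk => ?_⟩, (mem_cylAt_comm m).1 hty⟩
    rw [hty k (hk.trans_le hj), hy k hk]
  · rintro ⟨t, ⟨-, ht⟩, hy⟩ k hk
    rw [hy k (hk.trans_le hj), ht k hk]

lemma pairwise_disjoint_cylAt (L j : ℕ) (x : Gm m) :
    (↑(repsIn m L j x) : Set (Gm m)).Pairwise (Function.onFun Disjoint (cylAt m L)) := by
  intro s hs t ht hst
  refine Set.disjoint_left.2 fun y hys hyt => hst (funext fun k => ?_)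
  rcases lt_or_ge k L with hk | hk
  · rw [← hys k hk, hyt k hk]
  · rw [(mem_reps m).1 ((mem_repsIn m).1 hs).1 k hk, (mem_reps m).1 ((mem_repsIn m).1 ht).1 k hk]

variable {μ : Measure (Gm m)} (hμ : IsHaar m μ) (hm : ∀ k, 2 ≤ m k)
include hμ

omit [∀ k, NeZero (m k)] in
lemma measureReal_cylAt (j : ℕ) (x : Gm m) : μ.real (cylAt m j x) = (M m j : ℝ)⁻¹ := by
  rw [Measure.real, hμ j x, ENNReal.toReal_inv, ENNReal.toReal_natCast]

omit [∀ k, NeZero (m k)] in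
lemma IsHaar.isProbabilityMeasure : IsProbabilityMeasure μ := by
  refine ⟨?_⟩
  have : cylAt m 0 (0 : Gm m) = Set.univ := by ext; simp [cylAt]
  rw [← this, hμ]; simp [M]

section Integral

variable {F : Type*} [NormedAddCommGroup F] [NormedSpace ℝ F]

omit [∀ k, NeZero (m k)] [NormedSpace ℝ F] in
lemma integrableOn_cylAt {L : ℕ} {g : Gm m → F} (hg : DependsOn g (Set.Iio L)) (t : Gm m) :
    IntegrableOn g (cylAt m L t) μ := by
  have := hμ.isProbabilityMeasure
  refine IntegrableOn.congr_fun (f := fun _ => g t) (integrable_const _) (fun y hy => ?_)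
    (measurableSet_cylAt m L t)
  exact hg fun k hk => (hy k hk).symm

omit [NormedSpace ℝ F] in
lemma integrable_of_dependsOn {L : ℕ} {g : Gm m → F} (hg : DependsOn g (Set.Iio L)) :
    Integrable g μ := by
  rw [← integrableOn_univ]
  have : (Set.univ : Set (Gm m)) = cylAt m 0 0 := by ext; simp [cylAt]
  rw [this, cylAt_eq_biUnion m (Nat.zero_le L), integrableOn_finset_iUnion]
  exact fun t _ => integrableOn_cylAt m hμ hg t

lemma setIntegral_cylAt [CompleteSpace F] {L j : ℕ} (hj : j ≤ L) {g : Gm m → F}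
    (hg : DependsOn g (Set.Iio L)) (x : Gm m) :
    ∫ t in cylAt m j x, g t ∂μ = (M m L : ℝ)⁻¹ • ∑ t ∈ repsIn m L j x, g t := by
  rw [cylAt_eq_biUnion m hj, integral_biUnion_finset _ (fun t _ => measurableSet_cylAt m L t)
    (pairwise_disjoint_cylAt m L j x) (fun t _ => integrableOn_cylAt m hμ hg t), Finset.smul_sum]
  refine Finset.sum_congr rfl fun t _ => ?_
  rw [setIntegral_congr_fun (g := fun _ => g t) (measurableSet_cylAt m L t)
    fun y hy => hg fun k hk => hy k hk, setIntegral_const, measureReal_cylAt m hμ]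

lemma integral_eq_sum_reps [CompleteSpace F] {L : ℕ} {g : Gm m → F}
    (hg : DependsOn g (Set.Iio L)) :
    ∫ t, g t ∂μ = (M m L : ℝ)⁻¹ • ∑ t ∈ reps m L, g t := by
  rw [← repsIn_zero m L 0, ← setIntegral_cylAt m hμ (Nat.zero_le L) hg, ← setIntegral_univ]
  congr 2
  ext; simp [cylAt]

end Integral

include hm

lemma card_repsIn {L j : ℕ} (hj : j ≤ L) (x : Gm m) :
    (repsIn m L j x).card * M m j = M m L := by
  have h := setIntegral_cylAt m hμ hj (g := fun _ => (1 : ℝ)) (fun _ _ _ => rfl) x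
  have h1 : (M m j : ℝ) ≠ 0 := by exact_mod_cast (M_pos m hm j).ne'
  have h2 : (M m L : ℝ) ≠ 0 := by exact_mod_cast (M_pos m hm L).ne'
  rw [setIntegral_const, measureReal_cylAt m hμ] at h
  simp only [smul_eq_mul, mul_one, Finset.sum_const, nsmul_eq_mul] at h
  field_simp at h
  rw [mul_comm]
  exact_mod_cast h.symm

lemma sum_mul_sum_repsIn {R : Type*} [CommSemiring R] {L j : ℕ} (hj : j ≤ L) {φ : Gm m → R}
    (hφ : DependsOn φ (Set.Iio j)) (g : Gm m → R) :
    M m j * ∑ x ∈ reps m L, φ x * ∑ t ∈ repsIn m L j x, g t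
      = M m L * ∑ t ∈ reps m L, φ t * g t := by
  classical
  simp only [Finset.mul_sum]
  rw [Finset.sum_comm' (t' := reps m L) (s' := fun t => repsIn m L j t)]
  · refine Finset.sum_congr rfl fun t _ => ?_
    rw [Finset.sum_congr rfl fun x hx => by
      rw [hφ (y := t) fun k hk => ((mem_repsIn m).1 hx).2 k hk], Finset.sum_const, nsmul_eq_mul,
      ← card_repsIn m hμ hm hj t]
    push_cast
    ring
  · intro x t
    rw [mem_repsIn, mem_repsIn, mem_cylAt_comm]
    tauto

variable (L : ℕ)

omit hμ hm in
lemma sum_reps_add_single {R : Type*} [AddCommMonoid R] {s : ℕ} (hs : s < L) (y : ZMod (m s))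
    (u : Gm m → R) :
    ∑ x ∈ reps m L, u (x + Pi.single s y) = ∑ x ∈ reps m L, u x := by
  have key : ∀ z : ZMod (m s), ∀ x ∈ reps m L, x + Pi.single s z ∈ reps m L := fun z x hx => by
    rw [mem_reps] at hx ⊢
    intro k hk
    have : k ≠ s := by omega
    rw [Pi.add_apply, hx k hk, Pi.single_eq_of_ne this, add_zero]
  refine Finset.sum_nbij' (fun x => x + Pi.single s y) (fun x => x + Pi.single s (-y)) (key y)
    (key (-y)) ?_ ?_ fun _ _ => rfl
  · intro x _
    rw [add_assoc, ← Pi.single_add, add_neg_cancel, Pi.single_zero, add_zero]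
  · intro x _
    rw [add_assoc, ← Pi.single_add, neg_add_cancel, Pi.single_zero, add_zero]

/-- The mean value of a function of the first `L` coordinates. -/
def mean (g : Gm m → ℝ) : ℝ := (∑ t ∈ reps m L, g t) / M m L

/-- The conditional expectation given the first `j` coordinates of a function of the first `L`
coordinates. -/
def condMean (j : ℕ) (g : Gm m → ℝ) (x : Gm m) : ℝ :=
  M m j / M m L * ∑ t ∈ repsIn m L j x, g t

omit hμ hm in
lemma mean_mono {g h : Gm m → ℝ} (hgh : ∀ x, g x ≤ h x) : mean m L g ≤ mean m L h :=
  div_le_div_of_nonneg_right (Finset.sum_le_sum fun x _ => hgh x) (Nat.cast_nonneg _)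

omit hμ hm in
lemma mean_nonneg {g : Gm m → ℝ} (hg : ∀ x, 0 ≤ g x) : 0 ≤ mean m L g :=
  div_nonneg (Finset.sum_nonneg fun x _ => hg x) (Nat.cast_nonneg _)

omit hμ hm in
lemma mean_add (g h : Gm m → ℝ) : mean m L (fun x => g x + h x) = mean m L g + mean m L h := by
  rw [mean, Finset.sum_add_distrib, add_div]; rfl

omit hμ hm in
lemma mean_const_mul (c : ℝ) (g : Gm m → ℝ) : mean m L (fun x => c * g x) = c * mean m L g := by
  rw [mean, ← Finset.mul_sum, mul_div_assoc]; rfl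

omit hμ hm in
lemma mean_sum {ι : Type*} (s : Finset ι) (g : ι → Gm m → ℝ) :
    mean m L (fun x => ∑ i ∈ s, g i x) = ∑ i ∈ s, mean m L (g i) := by
  rw [mean, Finset.sum_comm, Finset.sum_div]; rfl

omit hμ hm in
lemma mean_add_single {s : ℕ} (hs : s < L) (y : ZMod (m s)) (u : Gm m → ℝ) :
    mean m L (fun x => u (x + Pi.single s y)) = mean m L u := by
  rw [mean, mean, sum_reps_add_single m L hs]

omit hm in
lemma integral_eq_mean {g : Gm m → ℝ} (hg : DependsOn g (Set.Iio L)) :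
    ∫ t, g t ∂μ = mean m L g := by
  rw [integral_eq_sum_reps m hμ hg, mean, smul_eq_mul, inv_mul_eq_div]

omit hμ hm in
lemma condMean_mono (j : ℕ) {g h : Gm m → ℝ} (hgh : ∀ x, g x ≤ h x) (x : Gm m) :
    condMean m L j g x ≤ condMean m L j h x :=
  mul_le_mul_of_nonneg_left (Finset.sum_le_sum fun x _ => hgh x) (by positivity)

omit hμ hm in
lemma condMean_nonneg (j : ℕ) {g : Gm m → ℝ} (hg : ∀ x, 0 ≤ g x) (x : Gm m) :
    0 ≤ condMean m L j g x :=
  mul_nonneg (by positivity) (Finset.sum_nonneg fun x _ => hg x)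

omit hμ hm in
lemma condMean_eq_of_mem {j : ℕ} {x t : Gm m} (h : t ∈ cylAt m j x) (g : Gm m → ℝ) :
    condMean m L j g t = condMean m L j g x := by
  rw [condMean, condMean, repsIn_eq_of_mem m h]

variable {L}

lemma condMean_const {j : ℕ} (hj : j ≤ L) (c : ℝ) (x : Gm m) :
    condMean m L j (fun _ => c) x = c := by
  have h2 : (M m L : ℝ) ≠ 0 := by exact_mod_cast (M_pos m hm L).ne'
  rw [condMean, Finset.sum_const, nsmul_eq_mul, div_mul_eq_mul_div, div_eq_iff h2, ← mul_assoc,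
    mul_comm (M m j : ℝ), ← Nat.cast_mul, card_repsIn m hμ hm hj, mul_comm]

lemma condMean_of_dependsOn {j : ℕ} (hj : j ≤ L) {g : Gm m → ℝ} (hg : DependsOn g (Set.Iio j))
    (x : Gm m) : condMean m L j g x = g x := by
  rw [← condMean_const m hμ hm hj (g x) x, condMean, condMean]
  congr 1
  exact Finset.sum_congr rfl fun t ht => hg fun k hk => ((mem_repsIn m).1 ht).2 k hk

lemma mean_condMean {j : ℕ} (hj : j ≤ L) (g : Gm m → ℝ) :
    mean m L (condMean m L j g) = mean m L g := by
  have h := sum_mul_sum_repsIn m hμ hm hj (φ := fun _ => (1 : ℝ)) (fun _ _ _ => rfl) g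
  have h2 : (M m L : ℝ) ≠ 0 := by exact_mod_cast (M_pos m hm L).ne'
  simp only [one_mul] at h
  simp only [mean, condMean]
  rw [← Finset.mul_sum, div_mul_eq_mul_div, h, mul_div_cancel_left₀ _ h2]

lemma le_condMean {j A : ℕ} (hjA : j ≤ A) (hA : A ≤ L) {g : Gm m → ℝ} (hg0 : ∀ x, 0 ≤ g x)
    (hg : DependsOn g (Set.Iio A)) {x t : Gm m} (ht : t ∈ cylAt m j x) :
    g t ≤ M m A / M m j * condMean m L j g x := by
  have h1 : (M m j : ℝ) ≠ 0 := by exact_mod_cast (M_pos m hm j).ne'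
  refine (condMean_of_dependsOn m hμ hm hA hg t).symm.le.trans ?_
  rw [← condMean_eq_of_mem m L ht, condMean, condMean, ← mul_assoc, div_mul_div_cancel₀ h1]
  exact mul_le_mul_of_nonneg_left (Finset.sum_le_sum_of_subset_of_nonneg (repsIn_subset m hjA t)
    fun y _ _ => hg0 y) (by positivity)

lemma condMean_sq_le {j A : ℕ} (hjA : j ≤ A) (hA : A ≤ L) {g : Gm m → ℝ} (hg0 : ∀ x, 0 ≤ g x)
    (hg : DependsOn g (Set.Iio A)) (x : Gm m) :
    condMean m L j (fun t => g t ^ 2) x ≤ M m A / M m j * condMean m L j g x ^ 2 := by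
  have hsplit (c : ℝ) :
      c * condMean m L j g x = M m j / M m L * ∑ t ∈ repsIn m L j x, c * g t := by
    rw [← Finset.mul_sum, condMean]
    ring
  rw [sq (condMean m L j g x), ← mul_assoc, hsplit, condMean]
  refine mul_le_mul_of_nonneg_left (Finset.sum_le_sum fun t ht => ?_) (by positivity)
  rw [sq]
  exact mul_le_mul_of_nonneg_right
    (le_condMean m hμ hm hjA hA hg0 hg ((mem_repsIn m).1 ht).2) (hg0 t)

omit hμ hm in
lemma sqrt_condMean_add_sq_le (j : ℕ) (a b : Gm m → ℝ) (x : Gm m) :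
    √(condMean m L j (fun t => (a t + b t) ^ 2) x)
      ≤ √(condMean m L j (fun t => a t ^ 2) x) + √(condMean m L j (fun t => b t ^ 2) x) := by
  have h := Real.Lp_add_le (repsIn m L j x) a b (p := 2) one_le_two
  have hc : (0 : ℝ) ≤ M m j / M m L := by positivity
  simp only [Real.rpow_two, sq_abs, ← Real.sqrt_eq_rpow] at h
  simp only [condMean, Real.sqrt_mul hc]
  rw [← mul_add]
  exact mul_le_mul_of_nonneg_left h (Real.sqrt_nonneg _)


/-- The `A`-th normalized square mean of `h` over cylinders of length `j`. -/
def sqMean (L j A : ℕ) (h : ℕ → Gm m → ℝ) : ℝ :=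
  mean m L fun x => √(M m j / M m A * condMean m L j (fun t => h A t ^ 2) x)

omit hμ hm in
lemma sqMean_nonneg (L j A : ℕ) (h : ℕ → Gm m → ℝ) : 0 ≤ sqMean m L j A h :=
  mean_nonneg m L fun _ => Real.sqrt_nonneg _

section Increments

variable {h : ℕ → Gm m → ℝ} (h0 : ∀ A x, 0 ≤ h A x) (hmono : ∀ A x, h A x ≤ h (A + 1) x)
  (hdep : ∀ A, DependsOn (h A) (Set.Iio A))
include hdep

include h0 in
lemma sqMean_self {j : ℕ} (hj : j ≤ L) : sqMean m L j j h = mean m L (h j) := by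
  have h1 : (M m j : ℝ) ≠ 0 := by exact_mod_cast (M_pos m hm j).ne'
  unfold sqMean
  congr 1
  funext x
  rw [div_self h1, one_mul, condMean_of_dependsOn m hμ hm hj, Real.sqrt_sq (h0 j x)]
  exact fun x y hxy => by rw [hdep j hxy]

include hmono

lemma sqMean_succ_le {j A : ℕ} (hjA : j ≤ A) (hA : A + 1 ≤ L) :
    sqMean m L j (A + 1) h ≤ 3 / 4 * sqMean m L j A h + (mean m L (h (A + 1)) - mean m L (h A)) := by
  set δ : Gm m → ℝ := fun x => h (A + 1) x - h A x with hδ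
  have hδ0 : ∀ x, 0 ≤ δ x := fun x => sub_nonneg.2 (hmono A x)
  have hδdep : DependsOn δ (Set.Iio (A + 1)) := fun x y hxy => by
    rw [hδ]
    simp only
    rw [hdep (A + 1) hxy, hdep A fun k hk => hxy k (Nat.lt_succ_of_lt hk)]
  have hMj : (0 : ℝ) < M m j := by exact_mod_cast M_pos m hm j
  have hMA : (0 : ℝ) < M m A := by exact_mod_cast M_pos m hm A
  have hMA1 : (0 : ℝ) < M m (A + 1) := by exact_mod_cast M_pos m hm (A + 1)
  have hMM : 2 * (M m A : ℝ) ≤ M m (A + 1) := by exact_mod_cast two_mul_M_le m hm A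
  have hmean : mean m L (h (A + 1)) - mean m L (h A) = mean m L (condMean m L j δ) := by
    rw [mean_condMean m hμ hm (hjA.trans (Nat.le_of_succ_le hA)), sub_eq_iff_eq_add, ← mean_add]
    congr 1
    funext x
    simp [hδ]
  rw [hmean, sqMean, sqMean, ← mean_const_mul, ← mean_add]
  refine mean_mono m L fun x => ?_
  have hle := sqrt_condMean_add_sq_le m (L := L) j (h A) δ x
  have e : (fun t => (h A t + δ t) ^ 2) = fun t => h (A + 1) t ^ 2 := by
    funext t; simp [hδ]
  rw [e] at hle
  have hA0 := condMean_nonneg m L j (fun t => sq_nonneg (h A t)) x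
  rw [Real.sqrt_mul (by positivity)]
  refine (mul_le_mul_of_nonneg_left hle (Real.sqrt_nonneg _)).trans ?_
  rw [mul_add, ← Real.sqrt_mul (by positivity), ← Real.sqrt_mul (by positivity)]
  refine add_le_add ?_ ?_
  · refine Real.sqrt_le_iff.2 ⟨by positivity, ?_⟩
    rw [mul_pow, Real.sq_sqrt (by positivity), ← mul_assoc]
    refine mul_le_mul_of_nonneg_right ?_ hA0
    rw [mul_div_assoc', div_le_div_iff₀ hMA1 hMA]
    nlinarith
  · refine Real.sqrt_le_iff.2 ⟨condMean_nonneg m L j hδ0 x, ?_⟩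
    have := condMean_sq_le m hμ hm (hjA.trans (Nat.le_succ A)) hA hδ0 hδdep x
    refine (mul_le_mul_of_nonneg_left this (by positivity)).trans_eq ?_
    field_simp

include h0 in
lemma sum_sqMean_le {j : ℕ} (D : ℕ) (hD : j + D ≤ L) :
    ∑ d ∈ Finset.range (D + 1), sqMean m L j (j + d) h + 3 * sqMean m L j (j + D) h
      ≤ 4 * mean m L (h (j + D)) := by
  induction D with
  | zero =>
    simp only [zero_add, Finset.sum_range_one, add_zero] at hD ⊢
    rw [sqMean_self m hμ hm h0 hdep hD]
    linarith
  | succ D ih =>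
    have h1 := ih (by omega)
    have h2 := sqMean_succ_le m hμ hm hmono hdep (Nat.le_add_right j D) (L := L) (by omega)
    rw [Finset.sum_range_succ]
    rw [← add_assoc j D 1]
    linarith

end Increments

lemma IsMartingale.sum_mul {f : ℕ → Gm m → ℂ} (hf : IsMartingale m μ f) {p : ℕ} (hp : p ≤ L)
    {φ : Gm m → ℂ} (hφ : DependsOn φ (Set.Iio p)) :
    ∑ x ∈ reps m L, φ x * f p x = ∑ x ∈ reps m L, φ x * f L x := by
  have h2 : (M m L : ℂ) ≠ 0 := by exact_mod_cast (M_pos m hm L).ne'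
  have h := sum_mul_sum_repsIn m hμ hm hp hφ (f L)
  have e : ∀ x, f p x = M m p * ((M m L : ℂ)⁻¹ * ∑ t ∈ repsIn m L p x, f L t) := fun x => by
    rw [hf.mart p L hp x, setIntegral_cylAt m hμ hp (fun _ _ => hf.adapted L _ _),
      Complex.real_smul]
    push_cast
    rfl
  rw [← mul_right_inj' h2, ← h, Finset.mul_sum, Finset.mul_sum]
  refine Finset.sum_congr rfl fun x _ => ?_
  rw [e]
  field_simp

lemma coeff_eq {f : ℕ → Gm m → ℂ} (hf : IsMartingale m μ f) {k J : ℕ} (hk : k < M m J)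
    (hJ : J ≤ L) (hkL : k + 1 ≤ L) :
    coeff m μ f k = (M m L : ℂ)⁻¹ * ∑ t ∈ reps m L, f J t * (starRingEnd ℂ) (vil m k t) := by
  have hv : ∀ p, k < M m p → DependsOn (fun t => (starRingEnd ℂ) (vil m k t)) (Set.Iio p) :=
    fun p hp x y hxy => by simp only [vil_congr m hm hp hxy]
  have hk1 : k < M m (k + 1) := (Nat.lt_succ_self k).trans (lt_M m hm _)
  have hd : DependsOn (fun x => f (k + 1) x * (starRingEnd ℂ) (vil m k x)) (Set.Iio L) :=
    fun x y hxy => by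
      simp only
      rw [vil_congr m hm hk1 fun i hi => hxy i (hi.trans_le hkL),
        hf.adapted (k + 1) x y fun i hi => hxy i (hi.trans_le hkL)]
  rw [coeff, integral_eq_sum_reps m hμ hd, Complex.real_smul]
  simp only [mul_comm (f _ _)]
  rw [hf.sum_mul m hμ hm hkL (hv _ hk1), hf.sum_mul m hμ hm hJ (hv _ hk)]
  push_cast
  rfl

omit [∀ k, NeZero (m k)] hμ hm in
lemma natCast_mul_sigma (f : ℕ → Gm m → ℂ) (n : ℕ) (x : Gm m) :
    n * sigma m μ f n x = ∑ i ∈ Finset.range n, ((n : ℂ) - i) * (coeff m μ f i * vil m i x) := by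
  rcases Nat.eq_zero_or_pos n with rfl | hn
  · simp
  have hn0 : (n : ℂ) ≠ 0 := by exact_mod_cast hn.ne'
  rw [sigma, ← mul_assoc, mul_inv_cancel₀ hn0, one_mul]
  clear hn hn0
  induction n with
  | zero => simp
  | succ n ih =>
    have : ∑ i ∈ Finset.range n, ((n : ℂ) - i) * (coeff m μ f i * vil m i x)
        = ∑ i ∈ Finset.range (n + 1), ((n : ℂ) - i) * (coeff m μ f i * vil m i x) := by
      rw [Finset.sum_range_succ, sub_self, zero_mul, add_zero]
    rw [Finset.sum_range_succ, ih, this, S, ← Finset.sum_add_distrib]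
    refine Finset.sum_congr rfl fun i _ => ?_
    push_cast
    ring

lemma natCast_mul_sigma_eq {f : ℕ → Gm m → ℂ} (hf : IsMartingale m μ f) {n J : ℕ}
    (hn : n < M m J) (hJ : J ≤ L) (hnL : n ≤ L) (x : Gm m) :
    n * sigma m μ f n x = (M m L : ℂ)⁻¹ * ∑ t ∈ reps m L, f J t * fejKer m n x t := by
  rw [natCast_mul_sigma]
  simp only [fejKer, Finset.mul_sum]
  rw [Finset.sum_comm]
  refine Finset.sum_congr rfl fun i hi => ?_
  have hi := Finset.mem_range.1 hi
  rw [coeff_eq m hμ hm hf (hi.trans hn) hJ (by omega)]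
  simp only [Finset.mul_sum, Finset.sum_mul]
  refine Finset.sum_congr rfl fun t _ => ?_
  rw [vilKer]
  ring

omit hμ hm in
lemma sum_mul_cylExcept_le {j s : ℕ} {g : Gm m → ℝ} (hg : ∀ x, 0 ≤ g x) (x : Gm m)
    [DecidablePred (· ∈ cylExcept m j s x)] :
    ∑ t ∈ reps m L, g t * (if t ∈ cylExcept m j s x then 1 else 0)
      ≤ ∑ y : ZMod (m s), ∑ t ∈ repsIn m L j (x + Pi.single s y), g t := by
  classical
  simp only [repsIn, Finset.sum_filter]
  rw [Finset.sum_comm]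
  refine Finset.sum_le_sum fun t _ => ?_
  have hnn : ∀ y ∈ (Finset.univ : Finset (ZMod (m s))),
      0 ≤ if t ∈ cylAt m j (x + Pi.single s y) then g t else 0 := fun y _ => by
    split_ifs
    exacts [hg t, le_rfl]
  by_cases ht : t ∈ cylExcept m j s x
  · refine le_trans ?_ (Finset.single_le_sum hnn (Finset.mem_univ (t s - x s)))
    rw [if_pos ht, mul_one, if_pos]
    intro k hk
    by_cases hks : k = s
    · subst hks
      simp
    · rw [Pi.add_apply, Pi.single_eq_of_ne hks, add_zero, ht k hk hks]
  · rw [if_neg ht, mul_zero]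
    exact Finset.sum_nonneg hnn

omit hμ hm in
lemma sum_mul_majKer_le {j : ℕ} {g : Gm m → ℝ} (hg : ∀ x, 0 ≤ g x) (x : Gm m) :
    (M m L : ℝ)⁻¹ * ∑ t ∈ reps m L, g t * (M m j * majKer m j x t)
      ≤ M m j * condMean m L j g x + ∑ s ∈ Finset.range j, ∑ y : ZMod (m s),
          M m s * condMean m L j g (x + Pi.single s y) := by
  classical
  have hc : (0 : ℝ) ≤ M m j / M m L := by positivity
  have e : (M m L : ℝ)⁻¹ * ∑ t ∈ reps m L, g t * (M m j * majKer m j x t)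
      = M m j * condMean m L j g x + ∑ s ∈ Finset.range j, M m s * ((M m j / M m L : ℝ) *
          ∑ t ∈ reps m L, g t * (if t ∈ cylExcept m j s x then 1 else 0)) := by
    have e1 : ∑ t ∈ repsIn m L j x, g t
        = ∑ t ∈ reps m L, g t * (if t ∈ cylAt m j x then 1 else 0) := by
      simp only [repsIn, Finset.sum_filter, mul_ite, mul_one, mul_zero]
    rw [condMean, e1]
    simp only [Finset.mul_sum]
    rw [Finset.sum_comm, ← Finset.sum_add_distrib]
    refine Finset.sum_congr rfl fun t _ => ?_
    rw [majKer, mul_add, mul_add, mul_add, Finset.mul_sum, Finset.mul_sum, Finset.mul_sum]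
    congr 1
    · ring
    · refine Finset.sum_congr rfl fun s _ => ?_
      ring
  rw [e]
  refine add_le_add le_rfl (Finset.sum_le_sum fun s _ => ?_)
  rw [← Finset.mul_sum]
  refine mul_le_mul_of_nonneg_left ?_ (Nat.cast_nonneg _)
  simp only [condMean]
  rw [← Finset.mul_sum]
  exact mul_le_mul_of_nonneg_left (sum_mul_cylExcept_le m hg x) hc

variable {lam : ℕ} (hlam : ∀ k, m k ≤ lam)
include hlam

lemma natCast_mul_norm_sigma_le {f : ℕ → Gm m → ℂ} (hf : IsMartingale m μ f) {n J : ℕ}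
    (hn : n < M m J) (hJ : J ≤ L) (hnL : n ≤ L) (x : Gm m) :
    n * ‖sigma m μ f n x‖ ≤ 2 * (lam : ℝ) ^ 3 * ∑ j ∈ Finset.range J,
      (M m j * condMean m L j (fun t => ‖f J t‖) x + ∑ s ∈ Finset.range j, ∑ y : ZMod (m s),
          M m s * condMean m L j (fun t => ‖f J t‖) (x + Pi.single s y)) := by
  have h1 : n * ‖sigma m μ f n x‖ = ‖(n : ℂ) * sigma m μ f n x‖ := by
    rw [norm_mul, Complex.norm_natCast]
  rw [h1, natCast_mul_sigma_eq m hμ hm hf hn hJ hnL, norm_mul, norm_inv, Complex.norm_natCast]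
  calc (M m L : ℝ)⁻¹ * ‖∑ t ∈ reps m L, f J t * fejKer m n x t‖
      ≤ (M m L : ℝ)⁻¹ * ∑ t ∈ reps m L, ‖f J t‖ *
          (2 * (lam : ℝ) ^ 3 * ∑ j ∈ Finset.range J, M m j * majKer m j x t) := by
        gcongr
        refine norm_sum_le_of_le _ fun t _ => ?_
        rw [norm_mul]
        exact mul_le_mul_of_nonneg_left (norm_fejKer_le m hm hlam J n hn x t) (norm_nonneg _)
    _ = 2 * (lam : ℝ) ^ 3 * ∑ j ∈ Finset.range J, (M m L : ℝ)⁻¹ * ∑ t ∈ reps m L,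
          ‖f J t‖ * (M m j * majKer m j x t) := by
        simp only [Finset.mul_sum]
        rw [Finset.sum_comm]
        refine Finset.sum_congr rfl fun j _ => Finset.sum_congr rfl fun t _ => ?_
        ring
    _ ≤ _ := by
        gcongr
        exact sum_mul_majKer_le m (fun _ => norm_nonneg _) x

omit [∀ k, NeZero (m k)] hμ hm hlam in
lemma sqrt_add_le {a b : ℝ} (ha : 0 ≤ a) (hb : 0 ≤ b) : √(a + b) ≤ √a + √b := by
  refine Real.sqrt_le_iff.2 ⟨by positivity, ?_⟩
  rw [add_sq, Real.sq_sqrt ha, Real.sq_sqrt hb]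
  have := mul_nonneg (Real.sqrt_nonneg a) (Real.sqrt_nonneg b)
  linarith

omit [∀ k, NeZero (m k)] hμ hm hlam in
lemma sqrt_sum_le {ι : Type*} (s : Finset ι) (g : ι → ℝ) (hg : ∀ i, 0 ≤ g i) :
    √(∑ i ∈ s, g i) ≤ ∑ i ∈ s, √(g i) := by
  classical
  induction s using Finset.induction_on with
  | empty => simp
  | insert a s ha ih =>
    rw [Finset.sum_insert ha, Finset.sum_insert ha]
    exact (sqrt_add_le (hg a) (Finset.sum_nonneg fun i _ => hg i)).trans (add_le_add le_rfl ih)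

omit [∀ k, NeZero (m k)] hμ hlam in
lemma sum_sqrt_M_le (j : ℕ) : ∑ s ∈ Finset.range j, √(M m s : ℝ) ≤ 3 * √(M m j : ℝ) := by
  induction j with
  | zero => simp
  | succ j ih =>
    rw [Finset.sum_range_succ]
    have hMM : 2 * (M m j : ℝ) ≤ M m (j + 1) := by exact_mod_cast two_mul_M_le m hm j
    have hM : (0 : ℝ) ≤ M m j := Nat.cast_nonneg _
    have : 4 * √(M m j : ℝ) ≤ 3 * √(M m (j + 1) : ℝ) := by
      refine abs_le_of_sq_le_sq' ?_ (by positivity) |>.2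
      rw [mul_pow, mul_pow, Real.sq_sqrt hM, Real.sq_sqrt (Nat.cast_nonneg _)]
      linarith
    linarith

lemma sqrt_mul_mean_sqrt_sigma_le {f : ℕ → Gm m → ℂ} (hf : IsMartingale m μ f) {n J : ℕ}
    (hn : n < M m J) (hJ : J ≤ L) (hnL : n ≤ L) :
    √(n : ℝ) * mean m L (fun x => √‖sigma m μ f n x‖)
      ≤ √(2 * (lam : ℝ) ^ 3) * ((1 + 3 * lam) * ∑ j ∈ Finset.range J, √(M m j : ℝ) *
          mean m L (fun x => √(condMean m L j (fun t => ‖f J t‖) x))) := by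
  set C : ℕ → Gm m → ℝ := fun j => condMean m L j (fun t => ‖f J t‖) with hC
  have hC0 : ∀ j x, 0 ≤ C j x := fun j => condMean_nonneg m L j fun _ => norm_nonneg _
  have hpt : ∀ x, √(n : ℝ) * √‖sigma m μ f n x‖ ≤ √(2 * (lam : ℝ) ^ 3) *
      ∑ j ∈ Finset.range J, (√(M m j : ℝ) * √(C j x) + ∑ s ∈ Finset.range j, ∑ y : ZMod (m s),
        √(M m s : ℝ) * √(C j (x + Pi.single s y))) := fun x => by
    rw [← Real.sqrt_mul (Nat.cast_nonneg _)]
    refine (Real.sqrt_le_sqrt (natCast_mul_norm_sigma_le m hμ hm hlam hf hn hJ hnL x)).trans ?_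
    rw [Real.sqrt_mul (by positivity)]
    have hM0 : ∀ k, (0 : ℝ) ≤ M m k := fun k => Nat.cast_nonneg _
    have h2 : ∀ j, 0 ≤ ∑ s ∈ Finset.range j, ∑ y : ZMod (m s),
        (M m s : ℝ) * C j (x + Pi.single s y) := fun j =>
      Finset.sum_nonneg fun s _ => Finset.sum_nonneg fun y _ => mul_nonneg (hM0 s) (hC0 _ _)
    refine mul_le_mul_of_nonneg_left ?_ (Real.sqrt_nonneg _)
    refine (sqrt_sum_le _ _ fun j => add_nonneg (mul_nonneg (hM0 j) (hC0 j x)) (h2 j)).trans ?_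
    refine Finset.sum_le_sum fun j _ => ?_
    refine (sqrt_add_le (mul_nonneg (hM0 j) (hC0 j x)) (h2 j)).trans ?_
    rw [Real.sqrt_mul (hM0 j)]
    refine add_le_add le_rfl ?_
    refine (sqrt_sum_le _ _ fun s => Finset.sum_nonneg fun y _ =>
      mul_nonneg (hM0 s) (hC0 _ _)).trans ?_
    refine Finset.sum_le_sum fun s _ => ?_
    refine (sqrt_sum_le _ _ fun y => mul_nonneg (hM0 s) (hC0 _ _)).trans_eq ?_
    exact Finset.sum_congr rfl fun y _ => Real.sqrt_mul (hM0 s) _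
  rw [← mean_const_mul]
  refine (mean_mono m L hpt).trans ?_
  rw [mean_const_mul, mean_sum]
  refine mul_le_mul_of_nonneg_left ?_ (Real.sqrt_nonneg _)
  rw [Finset.mul_sum]
  refine Finset.sum_le_sum fun j hj => ?_
  have hjJ := Finset.mem_range.1 hj
  have he0 : 0 ≤ mean m L fun x => √(C j x) := mean_nonneg m L fun _ => Real.sqrt_nonneg _
  have hshift : mean m L (fun x => ∑ s ∈ Finset.range j, ∑ y : ZMod (m s),
      √(M m s : ℝ) * √(C j (x + Pi.single s y)))
        = ∑ s ∈ Finset.range j, m s * √(M m s : ℝ) * mean m L fun x => √(C j x) := by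
    rw [mean_sum]
    refine Finset.sum_congr rfl fun s hs => ?_
    have hsL : s < L := (Finset.mem_range.1 hs).trans (hjJ.trans_le hJ)
    rw [mean_sum, Finset.sum_congr rfl fun y _ => by
      rw [mean_const_mul, mean_add_single m L hsL y fun x => √(C j x)], Finset.sum_const,
      Finset.card_univ, ZMod.card, nsmul_eq_mul, mul_assoc]
  rw [mean_add, mean_const_mul, hshift, ← Finset.sum_mul]
  have hsum : ∑ s ∈ Finset.range j, (m s : ℝ) * √(M m s : ℝ) ≤ lam * (3 * √(M m j : ℝ)) := by
    refine le_trans ?_ (mul_le_mul_of_nonneg_left (sum_sqrt_M_le m hm j) (Nat.cast_nonneg _))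
    rw [Finset.mul_sum]
    refine Finset.sum_le_sum fun s _ => mul_le_mul_of_nonneg_right ?_ (Real.sqrt_nonneg _)
    exact_mod_cast hlam s
  have := mul_le_mul_of_nonneg_right hsum he0
  linarith

lemma mean_sqrt_sigma_le {f : ℕ → Gm m → ℂ} (hf : IsMartingale m μ f) {h : ℕ → Gm m → ℝ}
    (hfh : ∀ A x, ‖f A x‖ ≤ h A x ^ 2) {n A : ℕ} (hAn : M m A ≤ n)
    (hn : n < M m (A + 1)) (hA : A + 1 ≤ L) (hnL : n ≤ L) :
    mean m L (fun x => √‖sigma m μ f n x‖)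
      ≤ √(2 * (lam : ℝ) ^ 3) * (1 + 3 * lam) * √(lam : ℝ) *
          ∑ j ∈ Finset.range (A + 1), sqMean m L j (A + 1) h := by
  have hn0 : (0 : ℝ) < n := by exact_mod_cast (M_pos m hm A).trans_le hAn
  have hMA : (0 : ℝ) < M m (A + 1) := by exact_mod_cast M_pos m hm (A + 1)
  have hMn : √(M m (A + 1) : ℝ) ≤ √(lam : ℝ) * √(n : ℝ) := by
    rw [← Real.sqrt_mul (Nat.cast_nonneg _)]
    refine Real.sqrt_le_sqrt ?_
    exact_mod_cast Nat.mul_le_mul (hlam A) hAn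
  have hterm : ∀ j, √(M m j : ℝ) * mean m L (fun x => √(condMean m L j (fun t => ‖f (A + 1) t‖) x))
      ≤ √(lam : ℝ) * √(n : ℝ) * sqMean m L j (A + 1) h := fun j => by
    refine le_trans ?_ (mul_le_mul_of_nonneg_right hMn (sqMean_nonneg m L j (A + 1) h))
    rw [sqMean, ← mean_const_mul, ← mean_const_mul]
    refine mean_mono m L fun x => ?_
    rw [← Real.sqrt_mul (Nat.cast_nonneg _), ← Real.sqrt_mul hMA.le, ← mul_assoc,
      mul_div_cancel₀ _ hMA.ne']
    exact Real.sqrt_le_sqrt (mul_le_mul_of_nonneg_left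
      (condMean_mono m L j (hfh (A + 1)) x) (Nat.cast_nonneg _))
  refine le_of_mul_le_mul_left ?_ (Real.sqrt_pos.2 hn0)
  refine (sqrt_mul_mean_sqrt_sigma_le m hμ hm hlam hf hn hA hnL).trans ?_
  calc _ ≤ √(2 * (lam : ℝ) ^ 3) * ((1 + 3 * lam) * ∑ j ∈ Finset.range (A + 1),
        √(lam : ℝ) * √(n : ℝ) * sqMean m L j (A + 1) h) := by
        refine mul_le_mul_of_nonneg_left (mul_le_mul_of_nonneg_left
          (Finset.sum_le_sum fun j _ => hterm j) (by positivity)) (Real.sqrt_nonneg _)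
    _ = _ := by
        rw [← Finset.mul_sum]
        ring

omit [∀ k, NeZero (m k)] hμ in
lemma sum_Ico_div_le {u v : ℕ → ℝ} (hv : ∀ A, 0 ≤ v A) (P : ℕ)
    (huv : ∀ A < P, ∀ n, M m A ≤ n → n < M m (A + 1) → u n ≤ v A) :
    ∑ n ∈ Finset.Ico 1 (M m P), u n / n ≤ lam * ∑ A ∈ Finset.range P, v A := by
  induction P with
  | zero => simp [M]
  | succ P ih =>
    have hMP := M_pos m hm P
    have hMP' : (0 : ℝ) < M m P := by exact_mod_cast hMP
    rw [← Finset.sum_Ico_consecutive _ hMP (M_le m hm (Nat.le_succ P)), Finset.sum_range_succ,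
      mul_add]
    refine add_le_add (ih fun A hA => huv A (hA.trans (Nat.lt_succ_self P))) ?_
    have hb : ∀ n ∈ Finset.Ico (M m P) (M m (P + 1)), u n / n ≤ v P / M m P := fun n hn => by
      rw [Finset.mem_Ico] at hn
      have : (M m P : ℝ) ≤ n := by exact_mod_cast hn.1
      exact div_le_div₀ (hv P) (huv P (Nat.lt_succ_self P) n hn.1 hn.2) hMP' this
    refine (Finset.sum_le_card_nsmul _ _ _ hb).trans ?_
    rw [Nat.card_Ico, nsmul_eq_mul, mul_div_assoc', div_le_iff₀ hMP', mul_right_comm]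
    refine mul_le_mul_of_nonneg_right ?_ (hv P)
    exact_mod_cast (Nat.sub_le _ _).trans (Nat.mul_le_mul_right _ (hlam P))

lemma sum_mean_sqrt_sigma_div_le {f : ℕ → Gm m → ℂ} (hf : IsMartingale m μ f)
    {h : ℕ → Gm m → ℝ} (hfh : ∀ A x, ‖f A x‖ ≤ h A x ^ 2) (h0 : ∀ A x, 0 ≤ h A x)
    (hmono : ∀ A x, h A x ≤ h (A + 1) x) (hdep : ∀ A, DependsOn (h A) (Set.Iio A)) {P : ℕ}
    (hP : M m P ≤ L) :
    ∑ n ∈ Finset.Ico 1 (M m P), mean m L (fun x => √‖sigma m μ f n x‖) / n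
      ≤ lam * (√(2 * (lam : ℝ) ^ 3) * (1 + 3 * lam) * √(lam : ℝ) * (P * (4 * mean m L (h P)))) := by
  have hPL : P ≤ L := (lt_M m hm P).le.trans hP
  refine (sum_Ico_div_le m hm hlam
    (u := fun n => mean m L (fun x => √‖sigma m μ f n x‖))
    (v := fun A => √(2 * (lam : ℝ) ^ 3) * (1 + 3 * lam) * √(lam : ℝ) *
          ∑ j ∈ Finset.range (A + 1), sqMean m L j (A + 1) h) (fun A => ?_) P
      fun A hA n hAn hn => ?_).trans ?_
  · exact mul_nonneg (by positivity) (Finset.sum_nonneg fun j _ => sqMean_nonneg m L j _ h)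
  · exact mean_sqrt_sigma_le m hμ hm hlam hf hfh hAn hn (by omega)
      (hn.le.trans ((M_le m hm hA).trans hP))
  · rw [← Finset.mul_sum]
    refine mul_le_mul_of_nonneg_left (mul_le_mul_of_nonneg_left ?_ (by positivity))
      (Nat.cast_nonneg _)
    rw [Finset.sum_comm' (t' := Finset.range P) (s' := fun j => Finset.Ico j P)]
    · have hb : ∀ j ∈ Finset.range P, ∑ A ∈ Finset.Ico j P, sqMean m L j (A + 1) h
          ≤ 4 * mean m L (h P) := fun j hj => by
        have hjP := (Finset.mem_range.1 hj).le
        have h1 := sum_sqMean_le m hμ hm h0 hmono hdep (L := L) (j := j) (P - j) (by omega)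
        rw [Nat.add_sub_cancel' hjP, Finset.sum_range_succ'] at h1
        rw [Finset.sum_Ico_eq_sum_range]
        have h2 := sqMean_nonneg m L j P h
        have h3 := sqMean_nonneg m L j (j + 0) h
        simp only [← add_assoc] at h1
        linarith
      refine (Finset.sum_le_card_nsmul _ _ _ hb).trans_eq ?_
      rw [Finset.card_range, nsmul_eq_mul]
    · intro A j
      simp only [Finset.mem_range, Finset.mem_Ico]
      omega

end FiniteModel

section MaximalFunction

variable (m : ℕ → ℕ)

/-- The square root of the truncated maximal function `max_{k ≤ A} |f^(k)|`. -/
def sqrtMax (f : ℕ → Gm m → ℂ) (A : ℕ) (x : Gm m) : ℝ :=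
  (Finset.range (A + 1)).sup' Finset.nonempty_range_add_one fun k => √‖f k x‖

lemma sqrt_norm_le_sqrtMax (f : ℕ → Gm m → ℂ) {k A : ℕ} (hk : k ≤ A) (x : Gm m) :
    √‖f k x‖ ≤ sqrtMax m f A x :=
  Finset.le_sup' (fun k => √‖f k x‖) (Finset.mem_range.2 (Nat.lt_succ_of_le hk))

lemma sqrtMax_nonneg (f : ℕ → Gm m → ℂ) (A : ℕ) (x : Gm m) : 0 ≤ sqrtMax m f A x :=
  (Real.sqrt_nonneg _).trans (sqrt_norm_le_sqrtMax m f (Nat.zero_le A) x)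

lemma norm_le_sqrtMax_sq (f : ℕ → Gm m → ℂ) (A : ℕ) (x : Gm m) :
    ‖f A x‖ ≤ sqrtMax m f A x ^ 2 :=
  (Real.sqrt_le_left (sqrtMax_nonneg m f A x)).1 (sqrt_norm_le_sqrtMax m f le_rfl x)

lemma sqrtMax_le_succ (f : ℕ → Gm m → ℂ) (A : ℕ) (x : Gm m) :
    sqrtMax m f A x ≤ sqrtMax m f (A + 1) x :=
  Finset.sup'_le _ _ fun _ hk => sqrt_norm_le_sqrtMax m f (Finset.mem_range.1 hk).le x

lemma dependsOn_sqrtMax {μ : Measure (Gm m)} {f : ℕ → Gm m → ℂ} (hf : IsMartingale m μ f)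
    (A : ℕ) : DependsOn (sqrtMax m f A) (Set.Iio A) := fun x y hxy => by
  refine Finset.sup'_congr _ rfl fun k hk => ?_
  rw [hf.adapted k x y fun i hi => hxy i (hi.trans_le (Nat.lt_succ_iff.1 (Finset.mem_range.1 hk)))]

lemma ofReal_sqrt_norm (z : ℂ) :
    ENNReal.ofReal √‖z‖ = (‖z‖₊ : ℝ≥0∞) ^ ((1 : ℝ) / 2) := by
  rw [Real.sqrt_eq_rpow, ← ENNReal.ofReal_rpow_of_nonneg (norm_nonneg _) (by norm_num),
    ofReal_norm]
  rfl

lemma ofReal_sqrtMax_le (f : ℕ → Gm m → ℂ) (A : ℕ) (x : Gm m) :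
    ENNReal.ofReal (sqrtMax m f A x) ≤ mstar m f x ^ ((1 : ℝ) / 2) := by
  obtain ⟨k, -, hk⟩ := Finset.exists_mem_eq_sup' Finset.nonempty_range_add_one
    (s := Finset.range (A + 1)) fun k => √‖f k x‖
  rw [sqrtMax, hk, ofReal_sqrt_norm]
  exact ENNReal.rpow_le_rpow (le_iSup (fun n => (‖f n x‖₊ : ℝ≥0∞)) k) (by norm_num)

lemma dependsOn_sigma (hm : ∀ k, 2 ≤ m k) (μ : Measure (Gm m)) (f : ℕ → Gm m → ℂ) {n L : ℕ}
    (hn : n ≤ L) : DependsOn (sigma m μ f n) (Set.Iio L) := fun x y hxy => by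
  rw [sigma, sigma]
  congr 1
  refine Finset.sum_congr rfl fun k hk => Finset.sum_congr rfl fun i hi => ?_
  rw [Finset.mem_range] at hk hi
  rw [vil_congr m hm ((lt_M m hm i).trans_le (M_le m hm (by omega : i ≤ L))) hxy]

lemma lintegral_eq_ofReal_mean [∀ k, NeZero (m k)] {μ : Measure (Gm m)} (hμ : IsHaar m μ) {L : ℕ}
    {g : Gm m → ℝ} (hg : DependsOn g (Set.Iio L)) (hg0 : ∀ x, 0 ≤ g x) :
    ∫⁻ x, ENNReal.ofReal (g x) ∂μ = ENNReal.ofReal (mean m L g) := by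
  rw [← integral_eq_mean m hμ L hg, ofReal_integral_eq_lintegral_ofReal
    (integrable_of_dependsOn m hμ hg) (Filter.Eventually.of_forall hg0)]

/-- The number of digits of `n` is at most `4 log n`. -/
lemma exists_lt_M_le_log (hm : ∀ k, 2 ≤ m k) {n : ℕ} (hn : 2 ≤ n) :
    ∃ P, n < M m P ∧ (P : ℝ) ≤ 4 * Real.log n := by
  classical
  have hex : ∃ P, n < M m P := ⟨n, lt_M m hm n⟩
  refine ⟨Nat.find hex, Nat.find_spec hex, ?_⟩
  obtain ⟨Q, hQ⟩ : ∃ Q, Nat.find hex = Q + 1 := Nat.exists_eq_succ_of_ne_zero fun h0 => by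
    have := Nat.find_spec hex
    rw [h0, M] at this
    omega
  have hQn : M m Q ≤ n := not_lt.1 (Nat.find_min hex (by omega))
  have h1 : (2 : ℝ) ^ Q ≤ n := by exact_mod_cast (two_pow_le_M m hm Q).trans hQn
  have h2 : Q * Real.log 2 ≤ Real.log n := by
    rw [← Real.log_pow]
    exact Real.log_le_log (by positivity) h1
  have h3 : Real.log 2 ≤ Real.log n := Real.log_le_log (by norm_num) (by exact_mod_cast hn)
  have h4 := Real.log_two_gt_d9
  have hQ0 : (0 : ℝ) ≤ Q := Nat.cast_nonneg _
  rw [hQ]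
  push_cast
  nlinarith

end MaximalFunction

end Vilenkin

/-- there is `c > 0` (depending only on `λ = sup m_k`) such that for
every martingale `f ∈ H_{1/2}` and every `n ≥ 2`,
`(1/log n) ∑_{k=1}^n ‖σ_k f‖_{L_{1/2}}^{1/2} / k ≤ c ‖f‖_{H_{1/2}}^{1/2}`. -/
theorem statement17 (lam : ℕ) :
    ∃ c : ℝ, 0 < c ∧
      ∀ (m : ℕ → ℕ), (∀ k, 2 ≤ m k) → (∀ k, m k ≤ lam) →
      ∀ (μ : Measure (Gm m)), Vilenkin.IsHaar m μ →
      ∀ (f : ℕ → Gm m → ℂ), Vilenkin.IsMartingale m μ f →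
        Vilenkin.MemHp m μ (1 / 2) f →
      ∀ (n : ℕ), 2 ≤ n →
        (ENNReal.ofReal (Real.log (n : ℝ)))⁻¹ *
            ∑ k ∈ Finset.range n,
              (∫⁻ x, (‖Vilenkin.sigma m μ f (k + 1) x‖₊ : ℝ≥0∞) ^ ((1 : ℝ) / 2) ∂μ) /
                ((k + 1 : ℕ) : ℝ≥0∞) ≤
          ENNReal.ofReal c * ∫⁻ x, Vilenkin.mstar m f x ^ ((1 : ℝ) / 2) ∂μ := by
  refine ⟨16 * (lam * (√(2 * (lam : ℝ) ^ 3) * (1 + 3 * lam) * √(lam : ℝ))) + 1, by positivity, ?_⟩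
  intro m hm hlam μ hμ f hf _ n hn
  have : ∀ k, NeZero (m k) := fun k => ⟨by have := hm k; omega⟩
  obtain ⟨P, hnP, hPlog⟩ := Vilenkin.exists_lt_M_le_log m hm hn
  set L := Vilenkin.M m P with hL
  set b := Vilenkin.mean m L (Vilenkin.sqrtMax m f P) with hb
  have hPL : P ≤ L := (Vilenkin.lt_M m hm P).le
  have hb0 : 0 ≤ b := Vilenkin.mean_nonneg m L (Vilenkin.sqrtMax_nonneg m f P)
  have hlog : 0 < Real.log (n : ℝ) := Real.log_pos (by exact_mod_cast hn)
  set u : ℕ → ℝ := fun k => Vilenkin.mean m L fun x => √‖Vilenkin.sigma m μ f k x‖ with hu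
  have hu0 : ∀ k, 0 ≤ u k := fun k => Vilenkin.mean_nonneg m L fun _ => Real.sqrt_nonneg _
  set C : ℝ := lam * (√(2 * (lam : ℝ) ^ 3) * (1 + 3 * lam) * √(lam : ℝ)) with hC
  have hC0 : 0 ≤ C := by positivity
  have hbint : ENNReal.ofReal b ≤ ∫⁻ x, Vilenkin.mstar m f x ^ ((1 : ℝ) / 2) ∂μ := by
    have hdep : DependsOn (Vilenkin.sqrtMax m f P) (Set.Iio L) := fun x y hxy =>
      Vilenkin.dependsOn_sqrtMax m hf P fun i hi => hxy i (hi.trans_le hPL)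
    rw [hb, ← Vilenkin.lintegral_eq_ofReal_mean m hμ hdep (Vilenkin.sqrtMax_nonneg m f P)]
    exact lintegral_mono fun x => Vilenkin.ofReal_sqrtMax_le m f P x
  have hterm : ∀ k ∈ Finset.range n,
      (∫⁻ x, (‖Vilenkin.sigma m μ f (k + 1) x‖₊ : ℝ≥0∞) ^ ((1 : ℝ) / 2) ∂μ) /
        ((k + 1 : ℕ) : ℝ≥0∞) = ENNReal.ofReal (u (k + 1) / (k + 1 : ℕ)) := fun k hk => by
    have hkL : k + 1 ≤ L := (Nat.succ_le_of_lt (Finset.mem_range.1 hk)).trans hnP.le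
    have hdep : DependsOn (fun x => √‖Vilenkin.sigma m μ f (k + 1) x‖) (Set.Iio L) :=
      fun x y hxy => by simp only [Vilenkin.dependsOn_sigma m hm μ f hkL hxy]
    rw [ENNReal.ofReal_div_of_pos (by positivity), ENNReal.ofReal_natCast, hu,
      ← Vilenkin.lintegral_eq_ofReal_mean m hμ hdep fun _ => Real.sqrt_nonneg _]
    simp only [Vilenkin.ofReal_sqrt_norm]
  have hsum : ∑ k ∈ Finset.range n, u (k + 1) / (k + 1 : ℕ) ≤ 16 * C * b * Real.log n := by
    have h1 : ∑ k ∈ Finset.range n, u (k + 1) / (k + 1 : ℕ)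
        ≤ ∑ k ∈ Finset.Ico 1 (Vilenkin.M m P), u k / k := by
      rw [Finset.range_eq_Ico, Finset.sum_Ico_add' (fun k => u k / (k : ℝ)) 0 n 1]
      exact Finset.sum_le_sum_of_subset_of_nonneg
        (Finset.Ico_subset_Ico (by omega) (Nat.succ_le_of_lt hnP))
        fun k _ _ => div_nonneg (hu0 k) (Nat.cast_nonneg _)
    have h2 := Vilenkin.sum_mean_sqrt_sigma_div_le m hμ hm hlam hf
      (Vilenkin.norm_le_sqrtMax_sq m f) (Vilenkin.sqrtMax_nonneg m f)
      (Vilenkin.sqrtMax_le_succ m f) (Vilenkin.dependsOn_sqrtMax m hf) hL.ge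
    rw [← mul_assoc, ← hC] at h2
    have h3 : C * (P * (4 * b)) ≤ C * (4 * Real.log n * (4 * b)) := by gcongr
    linarith
  rw [Finset.sum_congr rfl hterm, ← ENNReal.ofReal_sum_of_nonneg fun k _ =>
    div_nonneg (hu0 _) (Nat.cast_nonneg _), ← ENNReal.ofReal_inv_of_pos hlog,
    ← ENNReal.ofReal_mul (by positivity)]
  refine le_trans ?_ (mul_le_mul_right hbint _)
  rw [← ENNReal.ofReal_mul (by positivity)]
  refine ENNReal.ofReal_le_ofReal ?_
  rw [inv_mul_le_iff₀ hlog]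
  have := mul_nonneg hb0 hlog.le
  linarith
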